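/- arXiv:2601.04125 — 2 statements merged into one kernel-verified Lean document; each statement's English description precedes it below -/
import Mathlib

section
/- Suppose the field F has more than n−k elements, 1 < k < n−1 and k ≤ n−3. If 𝔗 is a special set of tops of Δ_k(V), then there exists a degenerate k-dimensional subspace X of F^n such that 𝔗 consists exactly of the tops T^c(Y) over all non-degenerate (k+1)-dimensional subspaces Y containing X. -/
open Module

section Defs

variable (F : Type*) [Field F]

/-- The `i`-th coordinate hyperplane in `F^n`: the kernel of the `i`-th coordinate functional. -/
def coordHyp (n : ℕ) (i : Fin n) : Submodule F (Fin n → F) :=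
  LinearMap.ker (LinearMap.proj (R := F) (φ := fun _ : Fin n => F) i)

/-- A subspace of `F^n` is degenerate if it is contained in some coordinate hyperplane. -/
def IsDeg (n : ℕ) (W : Submodule F (Fin n → F)) : Prop :=
  ∃ i : Fin n, W ≤ coordHyp F n i

/-- A subspace of `F^n` is non-degenerate if it is not degenerate. -/
def IsNondeg (n : ℕ) (W : Submodule F (Fin n → F)) : Prop :=
  ¬ IsDeg F n W

/-- Adjacency of `k`-dimensional subspaces: distinct with `(k-1)`-dimensional intersection. -/
def AdjK (n k : ℕ) (A B : Submodule F (Fin n → F)) : Prop :=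
  A ≠ B ∧ finrank F ↥(A ⊓ B) = k - 1

/-- The star `S(X)`: all `k`-dimensional subspaces containing `X`. -/
def Sstar (n k : ℕ) (X : Submodule F (Fin n → F)) : Set (Submodule F (Fin n → F)) :=
  {A | finrank F ↥A = k ∧ X ≤ A}

/-- `S^c(X)`: all non-degenerate `k`-dimensional subspaces containing `X`. -/
def Sc (n k : ℕ) (X : Submodule F (Fin n → F)) : Set (Submodule F (Fin n → F)) :=
  {A | finrank F ↥A = k ∧ X ≤ A ∧ IsNondeg F n A}

/-- `T^c(Y)`: all non-degenerate `k`-dimensional subspaces contained in `Y`. -/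
def Tc (n k : ℕ) (Y : Submodule F (Fin n → F)) : Set (Submodule F (Fin n → F)) :=
  {A | finrank F ↥A = k ∧ A ≤ Y ∧ IsNondeg F n A}

/-- A clique of `Δ_k(V)`: a set of non-degenerate `k`-dimensional subspaces which are
pairwise adjacent. -/
def IsCliqueD (n k : ℕ) (C : Set (Submodule F (Fin n → F))) : Prop :=
  (∀ A ∈ C, finrank F ↥A = k ∧ IsNondeg F n A) ∧
    ∀ A ∈ C, ∀ B ∈ C, A ≠ B → AdjK F n k A B

/-- A maximal clique of `Δ_k(V)`. -/
def IsMaxCliqueD (n k : ℕ) (C : Set (Submodule F (Fin n → F))) : Prop :=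
  IsCliqueD F n k C ∧ ∀ D, IsCliqueD F n k D → C ⊆ D → D = C

/-- A star of `Δ_k(V)`: a set `S^c(X)` which is a maximal clique of `Δ_k(V)`. -/
def IsStarD (n k : ℕ) (S : Set (Submodule F (Fin n → F))) : Prop :=
  (∃ X : Submodule F (Fin n → F), finrank F ↥X = k - 1 ∧ S = Sc F n k X) ∧
    IsMaxCliqueD F n k S

/-- A top of `Δ_k(V)`: a set `T^c(Y)` which is a maximal clique of `Δ_k(V)`. -/
def IsTopD (n k : ℕ) (T : Set (Submodule F (Fin n → F))) : Prop :=
  (∃ Y : Submodule F (Fin n → F), finrank F ↥Y = k + 1 ∧ T = Tc F n k Y) ∧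
    IsMaxCliqueD F n k T

/-- Adjacency of maximal cliques used in the graphs `Δ_s` and `Δ_t`:
two distinct cliques such that every vertex of each is adjacent to some vertex of the other. -/
def AdjMC (n k : ℕ) (C1 C2 : Set (Submodule F (Fin n → F))) : Prop :=
  C1 ≠ C2 ∧ (∀ A ∈ C1, ∃ B ∈ C2, AdjK F n k A B) ∧
    (∀ A ∈ C2, ∃ B ∈ C1, AdjK F n k A B)

/-- Adjacency in the graphs `Δ'_s` and `Δ'_t`: adjacent as above with empty intersection. -/
def AdjMC' (n k : ℕ) (C1 C2 : Set (Submodule F (Fin n → F))) : Prop :=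
  AdjMC F n k C1 C2 ∧ C1 ∩ C2 = ∅

/-- A clique of the graph `Δ_s` (whose vertices are the stars of `Δ_k(V)`). -/
def IsCliqueDs (n k : ℕ) (𝔖 : Set (Set (Submodule F (Fin n → F)))) : Prop :=
  (∀ S ∈ 𝔖, IsStarD F n k S) ∧ ∀ S ∈ 𝔖, ∀ S' ∈ 𝔖, S ≠ S' → AdjMC F n k S S'

/-- A maximal clique of `Δ_s`. -/
def IsMaxCliqueDs (n k : ℕ) (𝔖 : Set (Set (Submodule F (Fin n → F)))) : Prop :=
  IsCliqueDs F n k 𝔖 ∧ ∀ 𝔖', IsCliqueDs F n k 𝔖' → 𝔖 ⊆ 𝔖' → 𝔖' = 𝔖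

/-- A clique of the graph `Δ'_s`. -/
def IsCliqueDs' (n k : ℕ) (𝔖 : Set (Set (Submodule F (Fin n → F)))) : Prop :=
  (∀ S ∈ 𝔖, IsStarD F n k S) ∧ ∀ S ∈ 𝔖, ∀ S' ∈ 𝔖, S ≠ S' → AdjMC' F n k S S'

/-- A maximal clique of `Δ'_s`. -/
def IsMaxCliqueDs' (n k : ℕ) (𝔖 : Set (Set (Submodule F (Fin n → F)))) : Prop :=
  IsCliqueDs' F n k 𝔖 ∧ ∀ 𝔖', IsCliqueDs' F n k 𝔖' → 𝔖 ⊆ 𝔖' → 𝔖' = 𝔖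

/-- A special set of stars: a maximal clique in both `Δ_s` and `Δ'_s`. -/
def IsSpecialStars (n k : ℕ) (𝔖 : Set (Set (Submodule F (Fin n → F)))) : Prop :=
  IsMaxCliqueDs F n k 𝔖 ∧ IsMaxCliqueDs' F n k 𝔖

/-- A clique of the graph `Δ_t` (whose vertices are the tops of `Δ_k(V)`). -/
def IsCliqueDt (n k : ℕ) (𝔗 : Set (Set (Submodule F (Fin n → F)))) : Prop :=
  (∀ T ∈ 𝔗, IsTopD F n k T) ∧ ∀ T ∈ 𝔗, ∀ T' ∈ 𝔗, T ≠ T' → AdjMC F n k T T'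

/-- A maximal clique of `Δ_t`. -/
def IsMaxCliqueDt (n k : ℕ) (𝔗 : Set (Set (Submodule F (Fin n → F)))) : Prop :=
  IsCliqueDt F n k 𝔗 ∧ ∀ 𝔗', IsCliqueDt F n k 𝔗' → 𝔗 ⊆ 𝔗' → 𝔗' = 𝔗

/-- A clique of the graph `Δ'_t`. -/
def IsCliqueDt' (n k : ℕ) (𝔗 : Set (Set (Submodule F (Fin n → F)))) : Prop :=
  (∀ T ∈ 𝔗, IsTopD F n k T) ∧ ∀ T ∈ 𝔗, ∀ T' ∈ 𝔗, T ≠ T' → AdjMC' F n k T T'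

/-- A maximal clique of `Δ'_t`. -/
def IsMaxCliqueDt' (n k : ℕ) (𝔗 : Set (Set (Submodule F (Fin n → F)))) : Prop :=
  IsCliqueDt' F n k 𝔗 ∧ ∀ 𝔗', IsCliqueDt' F n k 𝔗' → 𝔗 ⊆ 𝔗' → 𝔗' = 𝔗

/-- A special set of tops: a maximal clique in both `Δ_t` and `Δ'_t`. -/
def IsSpecialTops (n k : ℕ) (𝔗 : Set (Set (Submodule F (Fin n → F)))) : Prop :=
  IsMaxCliqueDt F n k 𝔗 ∧ IsMaxCliqueDt' F n k 𝔗

/-- `𝔗_X`: the set of all `T^c(Y)` over non-degenerate `(k+1)`-dimensional `Y` containing `X`. -/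
def TopsThrough (n k : ℕ) (X : Submodule F (Fin n → F)) :
    Set (Set (Submodule F (Fin n → F))) :=
  {T | ∃ Y : Submodule F (Fin n → F),
    finrank F ↥Y = k + 1 ∧ IsNondeg F n Y ∧ X ≤ Y ∧ T = Tc F n k Y}

end Defs

section LinearAlgebra

variable {F V : Type*} [Field F] [AddCommGroup V] [Module F V]

theorem Submodule.finrank_sup_span_singleton_of_notMem [FiniteDimensional F V]
    {U : Submodule F V} {v : V} (hv : v ∉ U) :
    finrank F ↥(U ⊔ Submodule.span F {v}) = finrank F ↥U + 1 := by
  have hv0 : v ≠ 0 := by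
    rintro rfl
    exact hv U.zero_mem
  have h := Submodule.finrank_sup_add_finrank_inf_eq U (Submodule.span F {v})
  have hinf : U ⊓ Submodule.span F {v} = ⊥ :=
    ((Submodule.disjoint_span_singleton' hv0).2 hv).eq_bot
  rw [hinf, finrank_bot, finrank_span_singleton hv0] at h
  exact h

theorem Submodule.finrank_inf_lt_of_ne [FiniteDimensional F V] {A B : Submodule F V}
    (hAB : A ≠ B) (h : finrank F ↥A = finrank F ↥B) :
    finrank F ↥(A ⊓ B) < finrank F ↥A := by
  refine Submodule.finrank_lt_finrank_of_lt (lt_of_le_of_ne inf_le_left fun hA => hAB ?_)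
  exact Submodule.eq_of_le_of_finrank_eq (inf_eq_left.1 hA) h

theorem Submodule.finrank_inf_of_le [FiniteDimensional F V] {m : ℕ} {A B Y : Submodule F V}
    (hA : finrank F ↥A = m + 1) (hB : finrank F ↥B = m + 1) (hY : finrank F ↥Y = m + 2)
    (hAY : A ≤ Y) (hBY : B ≤ Y) (hAB : A ≠ B) : finrank F ↥(A ⊓ B) = m := by
  have h1 := Submodule.finrank_inf_lt_of_ne hAB (hA.trans hB.symm)
  have h2 := Submodule.finrank_sup_add_finrank_inf_eq A B
  have h3 := Submodule.finrank_mono (sup_le hAY hBY)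
  omega

theorem Submodule.exists_finrank_eq_between [FiniteDimensional F V] {U Y : Submodule F V}
    (hUY : U ≤ Y) {m : ℕ} (hm : finrank F ↥U ≤ m) (hmY : m ≤ finrank F ↥Y) :
    ∃ W : Submodule F V, U ≤ W ∧ W ≤ Y ∧ finrank F ↥W = m := by
  induction m, hm using Nat.le_induction with
  | base => exact ⟨U, le_rfl, hUY, rfl⟩
  | succ m _ ih =>
    obtain ⟨W, hUW, hWY, hW⟩ := ih (by omega)
    have hlt : W < Y := lt_of_le_of_ne hWY (by rintro rfl; omega)
    obtain ⟨v, hvY, hvW⟩ := SetLike.exists_of_lt hlt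
    refine ⟨W ⊔ Submodule.span F {v}, hUW.trans le_sup_left,
      sup_le hWY ((Submodule.span_singleton_le_iff_mem _ _).2 hvY), ?_⟩
    rw [Submodule.finrank_sup_span_singleton_of_notMem hvW, hW]

/-- The classical description of cliques in a Grassmann graph: a nonempty family of
`(k+1)`-dimensional subspaces pairwise meeting in dimension `k` either has a common
`k`-dimensional subspace, or lies in a common `(k+2)`-dimensional one. -/
theorem Submodule.exists_le_or_exists_ge_of_pairwise_finrank_inf [FiniteDimensional F V] {k : ℕ}
    {S : Set (Submodule F V)} (hne : S.Nonempty) (hS : ∀ Y ∈ S, finrank F ↥Y = k + 1)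
    (hadj : ∀ Y ∈ S, ∀ Y' ∈ S, Y ≠ Y' → finrank F ↥(Y ⊓ Y') = k) :
    (∃ X : Submodule F V, finrank F ↥X = k ∧ ∀ Y ∈ S, X ≤ Y) ∨
      ∃ Z : Submodule F V, finrank F ↥Z = k + 2 ∧ ∀ Y ∈ S, Y ≤ Z := by
  obtain ⟨Y₁, h₁⟩ := hne
  by_cases hsub : ∀ Y ∈ S, Y = Y₁
  · left
    obtain ⟨X, -, hX, hXk⟩ := Submodule.exists_finrank_eq_between (bot_le : ⊥ ≤ Y₁) (m := k)
      (by simp) (by have := hS Y₁ h₁; omega)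
    exact ⟨X, hXk, fun Y hY => hsub Y hY ▸ hX⟩
  push Not at hsub
  obtain ⟨Y₂, h₂, h21⟩ := hsub
  have hX := hadj Y₁ h₁ Y₂ h₂ h21.symm
  by_cases hall : ∀ Y ∈ S, Y₁ ⊓ Y₂ ≤ Y
  · exact Or.inl ⟨_, hX, hall⟩
  right
  push Not at hall
  have key : ∀ Y ∈ S, ∀ P Q : Submodule F V, P ≤ Y → Q ≤ Y → finrank F ↥P = k → ¬ Q ≤ P →
      Y ≤ P ⊔ Q := by
    intro Y hY P Q hP hQ hPk hQP
    have hlt : P < P ⊔ Q := lt_of_le_of_ne le_sup_left fun h => hQP (h ▸ le_sup_right)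
    have h1 := Submodule.finrank_lt_finrank_of_lt hlt
    have h2 := hS Y hY
    exact (Submodule.eq_of_le_of_finrank_le (sup_le hP hQ) (by omega)).ge
  have hout : ∀ Y ∈ S, ¬ Y₁ ⊓ Y₂ ≤ Y → Y ≤ Y₁ ⊔ Y₂ := by
    intro Y hY hXY
    have hY1 : Y ≠ Y₁ := by rintro rfl; exact hXY inf_le_left
    have hY2 : Y ≠ Y₂ := by rintro rfl; exact hXY inf_le_right
    have e1 := hadj Y hY Y₁ h₁ hY1
    have e2 := hadj Y hY Y₂ h₂ hY2
    refine (key Y hY _ _ inf_le_left inf_le_left e1 fun hle => hXY ?_).trans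
      (sup_le_sup inf_le_right inf_le_right)
    have : Y ⊓ Y₂ = Y₁ ⊓ Y₂ :=
      Submodule.eq_of_le_of_finrank_eq (le_inf (hle.trans inf_le_right) inf_le_right)
        (e2.trans hX.symm)
    exact this ▸ inf_le_left
  obtain ⟨Y₃, h₃, hX3⟩ := hall
  refine ⟨Y₁ ⊔ Y₂, ?_, fun Y hY => ?_⟩
  · have := Submodule.finrank_sup_add_finrank_inf_eq Y₁ Y₂
    rw [hS _ h₁, hS _ h₂, hX] at this
    omega
  by_cases hXY : Y₁ ⊓ Y₂ ≤ Y
  · have hY3 : Y ≠ Y₃ := by rintro rfl; exact hX3 hXY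
    have e3 := hadj Y hY Y₃ h₃ hY3
    refine (key Y hY _ (Y ⊓ Y₃) hXY inf_le_left hX fun hle => hX3 ?_).trans
      (sup_le (inf_le_left.trans le_sup_left) (inf_le_right.trans (hout _ h₃ hX3)))
    have : Y ⊓ Y₃ = Y₁ ⊓ Y₂ := Submodule.eq_of_le_of_finrank_eq hle (e3.trans hX.symm)
    exact this ▸ inf_le_right
  · exact hout Y hY hXY

end LinearAlgebra

section Nondegenerate

variable {F : Type*} [Field F] {n k : ℕ}

theorem mem_coordHyp {i : Fin n} {x : Fin n → F} : x ∈ coordHyp F n i ↔ x i = 0 := Iff.rfl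

theorem IsNondeg.mono {A B : Submodule F (Fin n → F)} (hA : IsNondeg F n A) (hAB : A ≤ B) :
    IsNondeg F n B :=
  fun ⟨i, hi⟩ => hA ⟨i, hAB.trans hi⟩

theorem natCast_lt_mk_of_finite {F : Type*} [Finite F] {m : ℕ}
    (hF : (↑m : Cardinal) < Cardinal.mk F) : m < Nat.card F := by
  rw [← Nat.cast_card] at hF
  exact_mod_cast hF

theorem card_add_finrank_le {U : Submodule F (Fin n → F)} {ι : Type*} [Finite ι]
    {f : ι → Fin n} (hf : Function.Injective f) (hU : ∀ x, U ≤ coordHyp F n (f x)) :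
    Nat.card ι + finrank F ↥U ≤ n := by
  classical
  have := Fintype.ofFinite ι
  let L : (Fin n → F) →ₗ[F] ({i // i ∉ Finset.univ.image f} → F) :=
    LinearMap.funLeft F F Subtype.val
  have hinj : Function.Injective (L ∘ₗ U.subtype) := by
    rw [← LinearMap.ker_eq_bot, LinearMap.ker_eq_bot']
    intro u hu
    ext i
    by_cases hi : i ∈ Finset.univ.image f
    · obtain ⟨x, -, rfl⟩ := Finset.mem_image.1 hi
      exact hU x u.2
    · exact congrFun hu ⟨i, hi⟩
  have h := LinearMap.finrank_le_finrank_of_injective hinj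
  rw [Module.finrank_fintype_fun_eq_card, Fintype.card_subtype_compl, Fintype.card_coe,
    Finset.card_image_of_injective _ hf, Fintype.card_fin, Finset.card_univ] at h
  have h2 : Fintype.card ι ≤ n := by simpa using Fintype.card_le_of_injective f hf
  rw [Nat.card_eq_fintype_card]
  omega

theorem exists_isNondeg_between {U Y : Submodule F (Fin n → F)} {m : ℕ}
    (hF : (↑(n - m - 1) : Cardinal) < Cardinal.mk F)
    (hU : finrank F ↥U = m) (hY : finrank F ↥Y = m + 2) (hUY : U ≤ Y) (hYn : IsNondeg F n Y) :
    ∃ B : Submodule F (Fin n → F), finrank F ↥B = m + 1 ∧ U ≤ B ∧ B ≤ Y ∧ IsNondeg F n B := by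
  have hlt : U < Y := lt_of_le_of_ne hUY (by rintro rfl; omega)
  obtain ⟨y₁, hy₁, hy₁U⟩ := SetLike.exists_of_lt hlt
  have hW := Submodule.finrank_sup_span_singleton_of_notMem hy₁U
  have hWY : U ⊔ Submodule.span F {y₁} ≤ Y :=
    sup_le hUY ((Submodule.span_singleton_le_iff_mem _ _).2 hy₁)
  have hlt2 : U ⊔ Submodule.span F {y₁} < Y := lt_of_le_of_ne hWY (by intro h; rw [h] at hW; omega)
  obtain ⟨y₂, hy₂, hy₂W⟩ := SetLike.exists_of_lt hlt2
  have hY' : Y ≤ U ⊔ Submodule.span F {y₁} ⊔ Submodule.span F {y₂} := by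
    refine (Submodule.eq_of_le_of_finrank_eq
      (sup_le hWY ((Submodule.span_singleton_le_iff_mem _ _).2 hy₂)) ?_).ge
    rw [Submodule.finrank_sup_span_singleton_of_notMem hy₂W, hW]
    omega
  let d : Option F → (Fin n → F) := fun o => o.elim y₂ fun a => y₁ + a • y₂
  have hdU : ∀ o, d o ∉ U := by
    rintro (_ | a) h
    · exact hy₂W (Submodule.mem_sup_left h)
    · change y₁ + a • y₂ ∈ U at h
      by_cases ha : a = 0
      · subst ha
        exact hy₁U (by simpa using h)
      · refine hy₂W ((Submodule.smul_mem_iff _ ha).1 ?_)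
        have h1 : y₁ ∈ U ⊔ Submodule.span F {y₁} :=
          Submodule.mem_sup_right (Submodule.mem_span_singleton_self _)
        simpa using Submodule.sub_mem _ (Submodule.mem_sup_left h) h1
  have hdY : ∀ o, d o ∈ Y := by
    rintro (_ | a)
    · exact hy₂
    · exact Y.add_mem hy₁ (Y.smul_mem a hy₂)
  by_contra hcon
  have hdeg : ∀ o, IsDeg F n (U ⊔ Submodule.span F {d o}) := by
    intro o
    by_contra ho
    exact hcon ⟨_, by rw [Submodule.finrank_sup_span_singleton_of_notMem (hdU o), hU],
      le_sup_left, sup_le hUY ((Submodule.span_singleton_le_iff_mem _ _).2 (hdY o)), ho⟩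
  choose f hf using hdeg
  have hUf : ∀ o, U ≤ coordHyp F n (f o) := fun o => le_sup_left.trans (hf o)
  have hdf : ∀ o, d o ∈ coordHyp F n (f o) := fun o =>
    hf o (Submodule.mem_sup_right (Submodule.mem_span_singleton_self _))
  have hspan : ∀ i, U ≤ coordHyp F n i → y₁ ∈ coordHyp F n i → y₂ ∈ coordHyp F n i → False :=
    fun i h0 h1 h2 => hYn ⟨i, hY'.trans (sup_le (sup_le h0
      ((Submodule.span_singleton_le_iff_mem _ _).2 h1))
      ((Submodule.span_singleton_le_iff_mem _ _).2 h2))⟩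
  have hinj : Function.Injective f := by
    intro o o' hoo
    by_contra hne
    have h1 := hdf o
    have h2 := hdf o'
    rw [← hoo] at h2
    have hkey : ∀ a, y₂ ∈ coordHyp F n (f o) → y₁ + a • y₂ ∈ coordHyp F n (f o) → False :=
      fun a e2 e1 => hspan _ (hUf o)
        (by simpa using Submodule.sub_mem _ e1 (Submodule.smul_mem _ a e2)) e2
    rcases o with _ | a <;> rcases o' with _ | b
    · exact hne rfl
    · exact hkey b h1 h2
    · exact hkey a h2 h1
    · have hab : a - b ≠ 0 := sub_ne_zero.2 fun h => hne (h ▸ rfl)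
      refine hkey a ((Submodule.smul_mem_iff _ hab).1 ?_) h1
      have := Submodule.sub_mem _ h1 h2
      change (y₁ + a • y₂) - (y₁ + b • y₂) ∈ _ at this
      rwa [add_sub_add_left_eq_sub, ← sub_smul] at this
  have : Finite (Option F) := Finite.of_injective f hinj
  have : Finite F := Finite.of_injective some (Option.some_injective F)
  have h1 := card_add_finrank_le hinj hUf
  rw [Finite.card_option, hU] at h1
  have h2 := natCast_lt_mk_of_finite hF
  omega

theorem exists_isNondeg_notMem {Y : Submodule F (Fin n → F)} (hk1 : 1 < k) (hkn : k + 2 ≤ n)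
    (hF : (↑(n - k) : Cardinal) < Cardinal.mk F)
    (hY : finrank F ↥Y = k + 1) (hYn : IsNondeg F n Y) {w : Fin n → F} (hwY : w ∈ Y)
    (hw : w ≠ 0) : ∃ B ∈ Tc F n k Y, w ∉ B := by
  by_contra! hcon
  let w' : Y := ⟨w, hwY⟩
  have hw' : w' ≠ 0 := fun h => hw (congrArg Subtype.val h)
  obtain ⟨g₀, hg₀⟩ : ∃ g₀ : Module.Dual F Y, g₀ w' = 1 := by
    obtain ⟨g, hg⟩ := Module.Projective.exists_dual_ne_zero F hw'
    exact ⟨(g w')⁻¹ • g, by simp [hg]⟩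
  let K : Submodule F (Module.Dual F Y) := LinearMap.ker (Module.Dual.eval F Y w')
  have hK : finrank F ↥K + 1 = k + 1 := by
    rw [← hY, ← Subspace.dual_finrank_eq (K := F) (V := ↥Y)]
    refine Module.Dual.finrank_ker_add_one_of_ne_zero fun h => ?_
    have := LinearMap.congr_fun h g₀
    simp [Module.Dual.eval_apply, hg₀] at this
  have hex : ∀ g : K, ∃ i : Fin n, w i ≠ 0 ∧
      ∀ y : Y, (y : Fin n → F) i = (g₀ + (g : Module.Dual F Y)) y * w i := by
    intro g
    set φ : Module.Dual F Y := g₀ + (g : Module.Dual F Y) with hφ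
    have hgw : (g : Module.Dual F Y) w' = 0 := g.2
    have hφw : φ w' = 1 := by simp [hφ, hg₀, hgw]
    have hφ0 : φ ≠ 0 := by
      intro h
      simp [h] at hφw
    have hdeg : IsDeg F n ((LinearMap.ker φ).map Y.subtype) := by
      by_contra hn
      have hmem := hcon _ ⟨?_, Submodule.map_subtype_le _ _, hn⟩
      · obtain ⟨y, hy, hyw⟩ := hmem
        have : y = w' := Subtype.ext hyw
        rw [this] at hy
        exact one_ne_zero (hφw.symm.trans hy)
      · have := Module.Dual.finrank_ker_add_one_of_ne_zero hφ0
        rw [Submodule.finrank_map_subtype_eq]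
        omega
    obtain ⟨i, hi⟩ := hdeg
    have hval : ∀ y : Y, (y : Fin n → F) i = φ y * w i := by
      intro y
      have hker : y - φ y • w' ∈ LinearMap.ker φ := by simp [hφw]
      have := mem_coordHyp.1 (hi (Submodule.mem_map_of_mem hker))
      exact sub_eq_zero.1 this
    refine ⟨i, fun hwi => hYn ⟨i, fun y hy => ?_⟩, hval⟩
    simpa [hwi, mem_coordHyp] using hval ⟨y, hy⟩
  choose f hf0 hf using hex
  have hinj : Function.Injective f := by
    intro g g' hgg
    refine Subtype.ext (LinearMap.ext fun y => ?_)
    have h := hf g y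
    rw [hgg, hf g' y] at h
    have := mul_right_cancel₀ (hf0 g') h
    simpa using this.symm
  have hfinK : Finite K := Finite.of_injective f hinj
  have : Nontrivial K := Module.nontrivial_of_finrank_pos (R := F) (by omega)
  obtain ⟨x, hx⟩ := exists_ne (0 : K)
  have : Finite F := Finite.of_injective (fun a : F => a • x) fun a b h =>
    sub_eq_zero.1 ((smul_eq_zero.1 ((sub_smul a b x).trans (sub_eq_zero.2 h))).resolve_right hx)
  have hcard := Nat.card_le_card_of_injective f hinj
  rw [Nat.card_fin, Module.natCard_eq_pow_finrank (K := F), show finrank F ↥K = k by omega]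
    at hcard
  have hq := natCast_lt_mk_of_finite hF
  obtain ⟨m, rfl⟩ : ∃ m, n = k + m := ⟨n - k, by omega⟩
  have h1 : (1 + m) ^ k ≤ Nat.card F ^ k := Nat.pow_le_pow_left (by omega) k
  have h2 : 1 + k * m ≤ (1 + m) ^ k := by
    simpa using one_add_mul_le_pow_of_sq_nonneg (R := ℕ) (a := m) (by simp) (by simp) (by simp) k
  nlinarith

theorem exists_mem_Tc_not_le {Y W : Submodule F (Fin n → F)} (hk1 : 1 < k) (hkn : k + 2 ≤ n)
    (hF : (↑(n - k) : Cardinal) < Cardinal.mk F)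
    (hY : finrank F ↥Y = k + 1) (hYn : IsNondeg F n Y) (hWY : W ≤ Y) (hW : W ≠ ⊥) :
    ∃ B ∈ Tc F n k Y, ¬ W ≤ B := by
  obtain ⟨w, hwW, hw⟩ := Submodule.exists_mem_ne_zero_of_ne_bot hW
  obtain ⟨B, hB, hwB⟩ := exists_isNondeg_notMem hk1 hkn hF hY hYn (hWY hwW) hw
  exact ⟨B, hB, fun h => hwB (h hwW)⟩

theorem Tc_nonempty {Y : Submodule F (Fin n → F)} (hk1 : 1 < k) (hkn : k + 2 ≤ n)
    (hF : (↑(n - k) : Cardinal) < Cardinal.mk F)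
    (hY : finrank F ↥Y = k + 1) (hYn : IsNondeg F n Y) : (Tc F n k Y).Nonempty := by
  obtain ⟨B, hB, -⟩ := exists_mem_Tc_not_le hk1 hkn hF hY hYn le_rfl
    (by rintro rfl; simp at hY)
  exact ⟨B, hB⟩

theorem isCliqueD_Tc {Y : Submodule F (Fin n → F)} (hk1 : 1 < k) (hY : finrank F ↥Y = k + 1) :
    IsCliqueD F n k (Tc F n k Y) := by
  obtain ⟨m, rfl⟩ : ∃ m, k = m + 1 := ⟨k - 1, by omega⟩
  exact ⟨fun A hA => ⟨hA.1, hA.2.2⟩, fun A hA B hB hAB =>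
    ⟨hAB, Submodule.finrank_inf_of_le hA.1 hB.1 hY hA.2.1 hB.2.1 hAB⟩⟩

theorem isTopD_Tc {Y : Submodule F (Fin n → F)} (hk1 : 1 < k) (hkn : k + 2 ≤ n)
    (hF : (↑(n - k) : Cardinal) < Cardinal.mk F)
    (hY : finrank F ↥Y = k + 1) (hYn : IsNondeg F n Y) : IsTopD F n k (Tc F n k Y) := by
  refine ⟨⟨Y, hY, rfl⟩, isCliqueD_Tc hk1 hY, fun D hD hYD => ?_⟩
  refine (Set.Subset.antisymm hYD fun A hA => ?_).symm
  by_contra hAT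
  have hAY : ¬ A ≤ Y := fun h => hAT ⟨(hD.1 A hA).1, h, (hD.1 A hA).2⟩
  have hlt : finrank F ↥(A ⊓ Y) < k := by
    rw [← (hD.1 A hA).1]
    exact Submodule.finrank_lt_finrank_of_lt (lt_of_le_of_ne inf_le_left
      fun h => hAY (inf_eq_left.1 h))
  have hle : ∀ B ∈ Tc F n k Y, A ⊓ Y ≤ B ∧ A ⊓ Y ≠ ⊥ := by
    intro B hB
    have hAB : A ≠ B := by rintro rfl; exact hAT hB
    have h := (hD.2 A hA B (hYD hB) hAB).2
    have heq : A ⊓ B = A ⊓ Y :=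
      Submodule.eq_of_le_of_finrank_le (inf_le_inf_left A hB.2.1) (by omega)
    refine ⟨heq ▸ inf_le_right, fun hbot => ?_⟩
    rw [heq, hbot, finrank_bot] at h
    omega
  obtain ⟨B, hB⟩ := Tc_nonempty hk1 hkn hF hY hYn
  obtain ⟨B', hB', hnle⟩ := exists_mem_Tc_not_le hk1 hkn hF hY hYn inf_le_right (hle B hB).2
  exact hnle (hle B' hB').1

theorem Tc_injective {Y Y' : Submodule F (Fin n → F)} (hk1 : 1 < k) (hkn : k + 2 ≤ n)
    (hF : (↑(n - k) : Cardinal) < Cardinal.mk F)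
    (hY : finrank F ↥Y = k + 1) (hYn : IsNondeg F n Y) (hY' : finrank F ↥Y' = k + 1)
    (h : Tc F n k Y = Tc F n k Y') : Y = Y' := by
  by_contra hne
  have hlt := Submodule.finrank_inf_lt_of_ne hne (hY.trans hY'.symm)
  have hle : ∀ B ∈ Tc F n k Y, B = Y ⊓ Y' := fun B hB =>
    Submodule.eq_of_le_of_finrank_le (le_inf hB.2.1 (h ▸ hB : B ∈ Tc F n k Y').2.1)
      (by have := hB.1; omega)
  obtain ⟨B, hB⟩ := Tc_nonempty hk1 hkn hF hY hYn
  have hbot : Y ⊓ Y' ≠ ⊥ := by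
    rw [← hle B hB]
    rintro rfl
    have := hB.1
    simp at this
    omega
  obtain ⟨B', hB', hnle⟩ := exists_mem_Tc_not_le hk1 hkn hF hY hYn inf_le_left hbot
  exact hnle (hle B' hB').ge

theorem exists_adjK_of_mem_Tc {Y Y' A : Submodule F (Fin n → F)} (hk1 : 1 < k) (hkn : k + 2 ≤ n)
    (hF : (↑(n - k) : Cardinal) < Cardinal.mk F)
    (hY : finrank F ↥Y = k + 1) (hY' : finrank F ↥Y' = k + 1) (hYn' : IsNondeg F n Y')
    (hinf : finrank F ↥(Y ⊓ Y') = k) (hA : A ∈ Tc F n k Y) :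
    ∃ B ∈ Tc F n k Y', AdjK F n k A B := by
  obtain ⟨m, rfl⟩ : ∃ m, k = m + 1 := ⟨k - 1, by omega⟩
  obtain ⟨hAk, hAY, hAn⟩ := hA
  by_cases hAZ : A = Y ⊓ Y'
  · have hA0 : A ≠ ⊥ := by rintro rfl; simp at hAk
    have hAY' : A ≤ Y' := hAZ ▸ inf_le_right
    obtain ⟨B, hB, hnle⟩ := exists_mem_Tc_not_le hk1 hkn hF hY' hYn' hAY' hA0
    have hAB : A ≠ B := fun h => hnle h.le
    exact ⟨B, hB, hAB, Submodule.finrank_inf_of_le hAk hB.1 hY' hAY' hB.2.1 hAB⟩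
  · have hU := Submodule.finrank_inf_of_le hAk hinf hY hAY inf_le_left hAZ
    obtain ⟨B, hBk, hUB, hBY', hBn⟩ := exists_isNondeg_between (by rwa [Nat.sub_sub]) hU hY'
      (inf_le_right.trans inf_le_right) hYn'
    have hAB : A ≠ B := by
      rintro rfl
      exact hAZ (Submodule.eq_of_le_of_finrank_eq (le_inf hAY hBY') (hAk.trans hinf.symm))
    refine ⟨B, ⟨hBk, hBY', hBn⟩, hAB, le_antisymm ?_ ?_⟩
    · have := Submodule.finrank_inf_lt_of_ne hAB (hAk.trans hBk.symm)
      omega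
    · rw [Nat.add_sub_cancel, ← hU]
      exact Submodule.finrank_mono (le_inf inf_le_left hUB)

theorem adjMC_Tc {Y Y' : Submodule F (Fin n → F)} (hk1 : 1 < k) (hkn : k + 2 ≤ n)
    (hF : (↑(n - k) : Cardinal) < Cardinal.mk F)
    (hY : finrank F ↥Y = k + 1) (hYn : IsNondeg F n Y) (hY' : finrank F ↥Y' = k + 1)
    (hYn' : IsNondeg F n Y') (hne : Y ≠ Y') (hinf : finrank F ↥(Y ⊓ Y') = k) :
    AdjMC F n k (Tc F n k Y) (Tc F n k Y') :=
  ⟨fun h => hne (Tc_injective hk1 hkn hF hY hYn hY' h),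
    fun _ hA => exists_adjK_of_mem_Tc hk1 hkn hF hY hY' hYn' hinf hA,
    fun _ hA => exists_adjK_of_mem_Tc hk1 hkn hF hY' hY hYn (by rwa [inf_comm]) hA⟩

theorem finrank_inf_of_adjMC {Y Y' : Submodule F (Fin n → F)} (hk1 : 1 < k) (hkn : k + 2 ≤ n)
    (hF : (↑(n - k) : Cardinal) < Cardinal.mk F)
    (hY : finrank F ↥Y = k + 1) (hYn : IsNondeg F n Y) (hY' : finrank F ↥Y' = k + 1)
    (h : AdjMC F n k (Tc F n k Y) (Tc F n k Y')) : finrank F ↥(Y ⊓ Y') = k := by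
  have hne : Y ≠ Y' := by rintro rfl; exact h.1 rfl
  have hlt := Submodule.finrank_inf_lt_of_ne hne (hY.trans hY'.symm)
  by_contra hk
  have hle : ∀ A ∈ Tc F n k Y, Y ⊓ Y' ≤ A ∧ Y ⊓ Y' ≠ ⊥ := by
    intro A hA
    obtain ⟨B, hB, -, hAB⟩ := h.2.1 A hA
    have heq : A ⊓ B = Y ⊓ Y' :=
      Submodule.eq_of_le_of_finrank_le (inf_le_inf hA.2.1 hB.2.1) (by omega)
    refine ⟨heq ▸ inf_le_left, fun hbot => ?_⟩
    rw [heq, hbot, finrank_bot] at hAB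
    omega
  obtain ⟨A, hA⟩ := Tc_nonempty hk1 hkn hF hY hYn
  obtain ⟨A', hA', hnle⟩ := exists_mem_Tc_not_le hk1 hkn hF hY hYn inf_le_left (hle A hA).2
  exact hnle (hle A' hA').1

theorem exists_isNondeg_finrank_eq {m : ℕ} (hm : 0 < m) (hmn : m ≤ n) :
    ∃ A : Submodule F (Fin n → F), finrank F ↥A = m ∧ IsNondeg F n A := by
  obtain ⟨A, hA1, -, hAm⟩ := Submodule.exists_finrank_eq_between
    (le_top : Submodule.span F {(1 : Fin n → F)} ≤ ⊤) (m := m)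
    ((finrank_span_le_card _).trans (by simpa using Nat.succ_le_of_lt hm)) (by simpa using hmn)
  exact ⟨A, hAm, fun ⟨i, hi⟩ => one_ne_zero (α := F)
    (mem_coordHyp.1 (hi (hA1 (Submodule.mem_span_singleton_self (1 : Fin n → F)))))⟩

theorem isNondeg_of_isTopD {Y : Submodule F (Fin n → F)} (hk : 0 < k) (hkn : k ≤ n)
    (hT : IsTopD F n k (Tc F n k Y)) : IsNondeg F n Y := by
  intro hYd
  have hempty : Tc F n k Y = ∅ :=
    Set.eq_empty_of_forall_notMem fun A hA => hA.2.2.mono hA.2.1 hYd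
  obtain ⟨A, hAk, hAn⟩ := exists_isNondeg_finrank_eq (F := F) hk hkn
  have h := hT.2.2 {A} ⟨by rintro _ rfl; exact ⟨hAk, hAn⟩, by
    rintro _ rfl _ rfl h
    exact absurd rfl h⟩ (by simp [hempty])
  exact Set.singleton_ne_empty A (h.trans hempty)

/-- A set of tops indexed by a family of nondegenerate `(k+1)`-dimensional subspaces pairwise
meeting in dimension `k` is a clique of `Δ_t`. -/
theorem isCliqueDt_image_Tc (hk1 : 1 < k) (hkn : k + 2 ≤ n)
    (hF : (↑(n - k) : Cardinal) < Cardinal.mk F) {S : Set (Submodule F (Fin n → F))}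
    (hS : ∀ Y ∈ S, finrank F ↥Y = k + 1 ∧ IsNondeg F n Y)
    (hadj : ∀ Y ∈ S, ∀ Y' ∈ S, Y ≠ Y' → finrank F ↥(Y ⊓ Y') = k) :
    IsCliqueDt F n k (Tc F n k '' S) := by
  constructor
  · rintro _ ⟨Y, hY, rfl⟩
    exact isTopD_Tc hk1 hkn hF (hS Y hY).1 (hS Y hY).2
  · rintro _ ⟨Y, hY, rfl⟩ _ ⟨Y', hY', rfl⟩ hne
    have hYY : Y ≠ Y' := by rintro rfl; exact hne rfl
    exact adjMC_Tc hk1 hkn hF (hS Y hY).1 (hS Y hY).2 (hS Y' hY').1 (hS Y' hY').2 hYY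
      (hadj Y hY Y' hY' hYY)

/-- Two distinct members of a clique of `Δ'_t` do not pass through a common nondegenerate
`k`-dimensional subspace. -/
theorem not_mem_of_isCliqueDt' {𝔗 : Set (Set (Submodule F (Fin n → F)))}
    (h𝔗 : IsCliqueDt' F n k 𝔗) {X : Submodule F (Fin n → F)} {T T' : Set (Submodule F (Fin n → F))}
    (hT : T ∈ 𝔗) (hXT : X ∈ T) (hne : T ≠ T') (hXT' : X ∈ T') : T' ∉ 𝔗 := fun hT' =>
  Set.notMem_empty X ((h𝔗.2 T hT T' hT' hne).2 ▸ ⟨hXT, hXT'⟩)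

end Nondegenerate

/-- for `|F| > n - k` and `k ≤ n - 3`, every special set of tops is the
set of all tops `T^c(Y)` with `Y` a non-degenerate `(k+1)`-dimensional subspace containing
a fixed degenerate `k`-dimensional subspace `X`. -/
theorem stmt11 (F : Type*) [Field F] (n k : ℕ)
    (hk1 : 1 < k) (hk2 : k < n - 1) (hk3 : k ≤ n - 3)
    (hF : (↑(n - k) : Cardinal) < Cardinal.mk F)
    (𝔗 : Set (Set (Submodule F (Fin n → F)))) (h𝔗 : IsSpecialTops F n k 𝔗) :
    ∃ X : Submodule F (Fin n → F), finrank F ↥X = k ∧ IsDeg F n X ∧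
      𝔗 = TopsThrough F n k X := by
  have hkn : k + 3 ≤ n := by omega
  have hkn2 : k + 2 ≤ n := by omega
  have hk : 0 < k := by omega
  obtain ⟨⟨hclique, hmax⟩, hclique', -⟩ := h𝔗
  let S : Set (Submodule F (Fin n → F)) :=
    {Y | finrank F ↥Y = k + 1 ∧ IsNondeg F n Y ∧ Tc F n k Y ∈ 𝔗}
  have h𝔗S : 𝔗 ⊆ Tc F n k '' S := by
    intro T hT
    have htop := hclique.1 T hT
    obtain ⟨⟨Y, hY, rfl⟩, -⟩ := id htop
    exact ⟨Y, ⟨hY, isNondeg_of_isTopD hk (by omega) htop, hT⟩, rfl⟩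
  have hSadj : ∀ Y ∈ S, ∀ Y' ∈ S, Y ≠ Y' → finrank F ↥(Y ⊓ Y') = k := by
    intro Y hY Y' hY' hne
    exact finrank_inf_of_adjMC hk1 hkn2 hF hY.1 hY.2.1 hY'.1 (hclique.2 _ hY.2.2 _ hY'.2.2
      fun h => hne (Tc_injective hk1 hkn2 hF hY.1 hY.2.1 hY'.1 h))
  have hSne : S.Nonempty := by
    by_contra hemp
    rw [Set.not_nonempty_iff_eq_empty] at hemp
    rw [hemp, Set.image_empty, Set.subset_empty_iff] at h𝔗S
    obtain ⟨Y, hY, hYn⟩ := exists_isNondeg_finrank_eq (F := F) (n := n) (m := k + 1)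
      (by omega) (by omega)
    have h := hmax (Tc F n k '' {Y}) (isCliqueDt_image_Tc hk1 hkn2 hF
      (by rintro _ rfl; exact ⟨hY, hYn⟩) (by rintro _ rfl _ rfl h; exact absurd rfl h))
      (by simp [h𝔗S])
    rw [h𝔗S, Set.image_singleton] at h
    exact Set.singleton_ne_empty _ h
  have hmax' : ∀ S' : Set (Submodule F (Fin n → F)),
      (∀ Y ∈ S', finrank F ↥Y = k + 1 ∧ IsNondeg F n Y) →
      (∀ Y ∈ S', ∀ Y' ∈ S', Y ≠ Y' → finrank F ↥(Y ⊓ Y') = k) → S ⊆ S' →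
      Tc F n k '' S' = 𝔗 := fun S' h1 h2 h3 =>
    hmax _ (isCliqueDt_image_Tc hk1 hkn2 hF h1 h2) (h𝔗S.trans (Set.image_mono h3))
  have hcontra : ∀ (X Y : Submodule F (Fin n → F)) (v : Fin n → F), finrank F ↥X = k → IsNondeg F n X → X ≤ Y → Y ∈ S → v ∉ Y →
      Tc F n k (X ⊔ Submodule.span F {v}) ∉ 𝔗 := by
    intro X Y v hXk hXn hXY hY hv
    have hvX : v ∉ X := fun h => hv (hXY h)
    have hYv : Y ≠ X ⊔ Submodule.span F {v} := by
      intro h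
      exact hv (h ▸ Submodule.mem_sup_right (Submodule.mem_span_singleton_self v))
    exact not_mem_of_isCliqueDt' hclique' hY.2.2 ⟨hXk, hXY, hXn⟩
      (fun h => hYv (Tc_injective hk1 hkn2 hF hY.1 hY.2.1
        (by rw [Submodule.finrank_sup_span_singleton_of_notMem hvX, hXk]) h))
      ⟨hXk, le_sup_left, hXn⟩
  obtain ⟨Y₀, hY₀⟩ := id hSne
  rcases Submodule.exists_le_or_exists_ge_of_pairwise_finrank_inf hSne (fun Y hY => hY.1) hSadj with
    ⟨X, hXk, hX⟩ | ⟨Z, hZk, hZ⟩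
  · have hTX : Tc F n k '' {Y | finrank F ↥Y = k + 1 ∧ IsNondeg F n Y ∧ X ≤ Y} = 𝔗 := by
      refine hmax' _ (fun Y hY => ⟨hY.1, hY.2.1⟩) (fun Y hY Y' hY' hne => le_antisymm ?_ ?_)
        fun Y hY => ⟨hY.1, hY.2.1, hX Y hY⟩
      · have := Submodule.finrank_inf_lt_of_ne hne (hY.1.trans hY'.1.symm)
        have := hY.1
        omega
      · rw [← hXk]
        exact Submodule.finrank_mono (le_inf hY.2.2 hY'.2.2)
    refine ⟨X, hXk, ?_, ?_⟩
    · by_contra hXn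
      obtain ⟨v, -, hv⟩ := SetLike.exists_of_lt (lt_top_iff_ne_top.2 (by
        rintro rfl
        have := hY₀.1
        simp at this
        omega) : Y₀ < ⊤)
      have hvX : v ∉ X := fun h => hv (hX Y₀ hY₀ h)
      refine hcontra X Y₀ v hXk hXn (hX Y₀ hY₀) hY₀ hv (hTX ▸ ⟨_, ⟨?_, ?_, le_sup_left⟩, rfl⟩)
      · rw [Submodule.finrank_sup_span_singleton_of_notMem hvX, hXk]
      · exact IsNondeg.mono hXn le_sup_left
    · rw [← hTX]
      ext T
      constructor
      · rintro ⟨Y, ⟨h1, h2, h3⟩, rfl⟩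
        exact ⟨Y, h1, h2, h3, rfl⟩
      · rintro ⟨Y, h1, h2, h3, rfl⟩
        exact ⟨Y, ⟨h1, h2, h3⟩, rfl⟩
  · have hTZ : Tc F n k '' {Y | finrank F ↥Y = k + 1 ∧ IsNondeg F n Y ∧ Y ≤ Z} = 𝔗 :=
      hmax' _ (fun Y hY => ⟨hY.1, hY.2.1⟩)
        (fun Y hY Y' hY' hne => Submodule.finrank_inf_of_le hY.1 hY'.1 hZk hY.2.2 hY'.2.2 hne)
        fun Y hY => ⟨hY.1, hY.2.1, hZ Y hY⟩
    obtain ⟨X, hXk, hXY, hXn⟩ := Tc_nonempty hk1 hkn2 hF hY₀.1 hY₀.2.1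
    obtain ⟨v, hvZ, hv⟩ := SetLike.exists_of_lt (lt_of_le_of_ne (hZ Y₀ hY₀) (by
      rintro rfl
      have := hY₀.1
      omega) : Y₀ < Z)
    have hvX : v ∉ X := fun h => hv (hXY h)
    refine absurd (hTZ ▸ ⟨_, ⟨?_, hXn.mono le_sup_left, sup_le (hXY.trans (hZ Y₀ hY₀))
      ((Submodule.span_singleton_le_iff_mem _ _).2 hvZ)⟩, rfl⟩)
      (hcontra X Y₀ v hXk hXn hXY hY₀ hv)
    rw [Submodule.finrank_sup_span_singleton_of_notMem hvX, hXk]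
end

section
/- Suppose the field F has more than n−k elements, 1 < k < n−1 and k ≥ 3. Then there is a graph isomorphism between Γ_s and the Grassmann graph Γ_k(V) whose restriction to the set of non-degenerate k-dimensional subspaces is the identity. -/
open Module

/-- The Grassmann graph `Γ_k(V)`: vertices are the `k`-dimensional subspaces of `F^n`,
two distinct ones being adjacent when their intersection is `(k-1)`-dimensional. -/
def GrassmannGraph (F : Type*) [Field F] (n k : ℕ) :
    SimpleGraph {A : Submodule F (Fin n → F) // finrank F ↥A = k} :=
  SimpleGraph.fromRel fun A B => finrank F ↥(A.1 ⊓ B.1) = k - 1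

/-- The graph `Γ_s`: vertices are the non-degenerate `k`-dimensional subspaces together
with the special sets of stars; a subspace is joined to a special set iff it belongs to some
star of that set; two special sets are joined iff some star belongs to both. -/
def GammaS (F : Type*) [Field F] (n k : ℕ) :
    SimpleGraph
      ({A : Submodule F (Fin n → F) // finrank F ↥A = k ∧ IsNondeg F n A} ⊕
        {𝔖 : Set (Set (Submodule F (Fin n → F))) // IsSpecialStars F n k 𝔖}) :=
  SimpleGraph.fromRel fun v w =>
    match v, w with
    | Sum.inl A, Sum.inl B => AdjK F n k A.1 B.1
    | Sum.inl A, Sum.inr 𝔖 => ∃ S ∈ 𝔖.1, A.1 ∈ S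
    | Sum.inr 𝔖, Sum.inl A => ∃ S ∈ 𝔖.1, A.1 ∈ S
    | Sum.inr 𝔖1, Sum.inr 𝔖2 => ∃ S, S ∈ 𝔖1.1 ∧ S ∈ 𝔖2.1

theorem exists_notMem_of_lt_mk {α : Type*} {m : ℕ} (hm : (m : Cardinal) < Cardinal.mk α)
    (T : Finset α) (hT : T.card ≤ m) : ∃ t, t ∉ T := by
  by_contra! h
  refine hm.not_ge ?_
  have huniv : (T : Set α) = Set.univ := Set.eq_univ_of_forall h
  rw [← Cardinal.mk_univ, ← huniv, Finset.coe_sort_coe, Cardinal.mk_coe_finset]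
  exact_mod_cast hT

namespace Submodule

variable {F V : Type*} [Field F] [AddCommGroup V] [Module F V]

/-- A subspace `A` not contained in any of at most `m + 1` coordinate hyperplanes has a vector
lying in none of them, provided that every set of `m` scalars can be avoided. -/
theorem exists_mem_forall_ne_zero {ι : Type*} {m : ℕ}
    (hF : ∀ T : Finset F, T.card ≤ m → ∃ t, t ∉ T) (f : ι → V →ₗ[F] F) {A : Submodule F V}
    (hA : ∀ i, ∃ a ∈ A, f i a ≠ 0) (I : Finset ι) (hI : I.card ≤ m + 1) :
    ∃ a ∈ A, ∀ i ∈ I, f i a ≠ 0 := by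
  classical
  induction I using Finset.induction_on with
  | empty => exact ⟨0, A.zero_mem, by simp⟩
  | insert i I hi ih =>
    rw [Finset.card_insert_of_notMem hi] at hI
    obtain ⟨a, haA, ha⟩ := ih (by omega)
    obtain ⟨b, hbA, hb⟩ := hA i
    by_cases hai : f i a = 0
    · obtain ⟨t, ht⟩ := hF (I.image fun j => -f j b / f j a)
        (Finset.card_image_le.trans (by omega))
      refine ⟨b + t • a, A.add_mem hbA (A.smul_mem _ haA), fun j hj => ?_⟩
      rcases Finset.mem_insert.1 hj with rfl | hj
      · simpa [hai] using hb
      · intro h0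
        refine ht (Finset.mem_image.2 ⟨j, hj, ?_⟩)
        rw [div_eq_iff (ha j hj)]
        simp only [map_add, map_smul, smul_eq_mul] at h0
        linear_combination -h0
    · exact ⟨a, haA, by simpa [hai] using ha⟩

variable [FiniteDimensional F V]

/-- Between `Z` and `Y` there is a hyperplane of `Y` avoiding a given vector of `Y` outside `Z`. -/
theorem exists_finrank_add_one_eq_of_notMem {Z Y : Submodule F V} (hZY : Z ≤ Y) {z : V}
    (hzY : z ∈ Y) (hzZ : z ∉ Z) :
    ∃ X : Submodule F V, Z ≤ X ∧ X ≤ Y ∧ finrank F X + 1 = finrank F Y ∧ z ∉ X := by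
  obtain ⟨f, hfz, hf⟩ := exists_le_ker_of_notMem hzZ
  have hz : z ∉ Y ⊓ LinearMap.ker f := fun h => hfz h.2
  refine ⟨Y ⊓ LinearMap.ker f, le_inf hZY hf, inf_le_left, ?_, hz⟩
  rw [← finrank_sup_span_singleton hz]
  suffices h : Y ⊓ LinearMap.ker f ⊔ span F {z} = Y by rw [h]
  refine le_antisymm (sup_le inf_le_left ((span_singleton_le_iff_mem z Y).2 hzY)) fun y hy => ?_
  refine mem_sup.2 ⟨y - (f y / f z) • z, ⟨Y.sub_mem hy (Y.smul_mem _ hzY), ?_⟩,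
    (f y / f z) • z, smul_mem _ _ (mem_span_singleton_self z), by simp⟩
  simp [hfz]

theorem exists_finrank_eq {d : ℕ} (hd : d ≤ finrank F V) :
    ∃ W : Submodule F V, finrank F W = d := by
  induction d with
  | zero => exact ⟨⊥, finrank_bot F V⟩
  | succ d ih =>
    obtain ⟨W, hW⟩ := ih (by omega)
    have hlt : W < ⊤ := by
      refine lt_top_iff_ne_top.2 ?_
      rintro rfl
      rw [finrank_top] at hW
      omega
    obtain ⟨v, -, hv⟩ := SetLike.exists_of_lt hlt
    exact ⟨W ⊔ span F {v}, by rw [finrank_sup_span_singleton hv, hW]⟩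

/-- A hyperplane `X` of `A` is the intersection of `A` with any subspace containing `X`
but not `A`. -/
theorem inf_eq_of_finrank_add_one_eq {X A P : Submodule F V} (hXA : X ≤ A)
    (hdim : finrank F X + 1 = finrank F A) (hXP : X ≤ P) (hAP : ¬A ≤ P) : A ⊓ P = X := by
  refine (eq_of_le_of_finrank_le (le_inf hXA hXP) ?_).symm
  have := finrank_lt_finrank_of_lt (inf_lt_left.2 hAP)
  omega

end Submodule

section Stars

variable {F : Type*} [Field F] {n k : ℕ}

theorem isNondeg_iff {W : Submodule F (Fin n → F)} :
    IsNondeg F n W ↔ ∀ i, ∃ w ∈ W, w i ≠ 0 := by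
  simp [IsNondeg, IsDeg, coordHyp, SetLike.le_def]

theorem IsNondeg.mono_s12 {W W' : Submodule F (Fin n → F)} (h : IsNondeg F n W) (hle : W ≤ W') :
    IsNondeg F n W' :=
  fun ⟨i, hi⟩ => h ⟨i, hle.trans hi⟩

/-- Vectors without zero coordinates span the space as soon as `F` has a third element. -/
theorem exists_notMem_forall_ne_zero {c : F} (hc0 : c ≠ 0) (hc1 : c ≠ 1)
    {W : Submodule F (Fin n → F)} (hW : W ≠ ⊤) :
    ∃ v : Fin n → F, v ∉ W ∧ ∀ i, v i ≠ 0 := by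
  by_cases h1 : (1 : Fin n → F) ∈ W
  · have : ∃ i, Pi.single i (1 : F) ∉ W := by
      by_contra! h
      refine hW (eq_top_iff.2 fun x _ => ?_)
      rw [pi_eq_sum_univ' x]
      refine W.sum_mem fun i _ => W.smul_mem _ ?_
      convert h i using 1
    obtain ⟨i, hi⟩ := this
    refine ⟨1 + (c - 1) • Pi.single i 1, fun hmem => hi ?_, fun j => ?_⟩
    · have h2 := (W.add_mem_iff_right h1).1 hmem
      exact (W.smul_mem_iff (sub_ne_zero.2 hc1)).1 h2
    · by_cases hj : j = i
      · subst hj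
        simpa using hc0
      · simp [hj]
  · exact ⟨1, h1, fun i => by simp⟩

/-- A subspace of dimension `d` lies in at most `n - d` coordinate hyperplanes. -/
theorem card_add_finrank_le_s12 {X : Submodule F (Fin n → F)} {I : Finset (Fin n)}
    (hI : ∀ i ∈ I, X ≤ coordHyp F n i) : I.card + finrank F X ≤ n := by
  let f : X →ₗ[F] ({i // i ∉ I} → F) :=
    (LinearMap.funLeft F F (Subtype.val : {i // i ∉ I} → Fin n)).comp X.subtype
  have hf : Function.Injective f := by
    rw [← LinearMap.ker_eq_bot, LinearMap.ker_eq_bot']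
    intro x hx
    ext i
    by_cases hi : i ∈ I
    · exact hI i hi x.2
    · exact congrFun hx ⟨i, hi⟩
  have h := LinearMap.finrank_le_finrank_of_injective hf
  rw [Module.finrank_fintype_fun_eq_card, Fintype.card_subtype_compl] at h
  simp only [Fintype.card_fin, Fintype.card_coe] at h
  have := I.card_le_univ
  simp only [Fintype.card_fin] at this
  omega

theorem exists_mem_Sc_not_le {c : F} (hc0 : c ≠ 0) (hc1 : c ≠ 1)
    {X W : Submodule F (Fin n → F)} (hX : finrank F X + 1 = k) (hXW : X ≤ W)
    (hW : finrank F W < n) : ∃ A ∈ Sc F n k X, ¬A ≤ W := by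
  have hW' : W ≠ ⊤ := by
    rintro rfl
    simp at hW
  obtain ⟨v, hvW, hv⟩ := exists_notMem_forall_ne_zero hc0 hc1 hW'
  have hvA : v ∈ X ⊔ Submodule.span F {v} :=
    Submodule.mem_sup_right (Submodule.mem_span_singleton_self v)
  refine ⟨X ⊔ Submodule.span F {v}, ⟨?_, le_sup_left, ?_⟩, fun h => hvW (h hvA)⟩
  · rw [Submodule.finrank_sup_span_singleton (fun h => hvW (hXW h)), hX]
  · exact isNondeg_iff.2 fun i => ⟨v, hvA, hv i⟩

theorem finrank_inf_add_one_of_adjK {A B : Submodule F (Fin n → F)} (hk : 2 ≤ k)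
    (h : AdjK F n k A B) : finrank F ↥(A ⊓ B) + 1 = k := by
  have := h.2
  omega

theorem finrank_inf_add_one_of_mem_Sc {X A B : Submodule F (Fin n → F)}
    (hX : finrank F X + 1 = k) (hA : A ∈ Sc F n k X) (hB : B ∈ Sc F n k X) (hAB : A ≠ B) :
    A ⊓ B = X := by
  refine Submodule.inf_eq_of_finrank_add_one_eq hA.2.1 (hX.trans hA.1.symm) hB.2.1 fun h => hAB ?_
  exact Submodule.eq_of_le_of_finrank_eq h (hA.1.trans hB.1.symm)

/-- Every set `S^c(X)` with `X` of dimension `k - 1` is a maximal clique. -/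
theorem isStarD_Sc (hk : 2 ≤ k) (hkn : k + 2 ≤ n) {c : F} (hc0 : c ≠ 0) (hc1 : c ≠ 1)
    {X : Submodule F (Fin n → F)} (hX : finrank F X + 1 = k) : IsStarD F n k (Sc F n k X) := by
  refine ⟨⟨X, by omega, rfl⟩, ⟨fun A hA => ⟨hA.1, hA.2.2⟩, fun A hA B hB hAB => ⟨hAB, ?_⟩⟩,
    fun D hD hXD => subset_antisymm (fun B hB => ⟨(hD.1 B hB).1, ?_, (hD.1 B hB).2⟩) hXD⟩
  · rw [finrank_inf_add_one_of_mem_Sc hX hA hB hAB]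
    omega
  by_contra hXB
  have hadj : ∀ A ∈ Sc F n k X, finrank F ↥(A ⊓ B) + 1 = k := fun A hA =>
    finrank_inf_add_one_of_adjK hk (hD.2 A (hXD hA) B hB fun h => hXB (h ▸ hA.2.1))
  have hBdim := (hD.1 B hB).1
  have hXlt : finrank F X < n := by omega
  obtain ⟨A, hA, -⟩ := exists_mem_Sc_not_le hc0 hc1 hX le_rfl hXlt
  have hsup : finrank F ↥(X ⊔ B) < n := by
    have h1 := Submodule.finrank_mono (sup_le_sup_right hA.2.1 B)
    have h2 := Submodule.finrank_sup_add_finrank_inf_eq A B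
    have h3 := hadj A hA
    have h4 := hA.1
    omega
  obtain ⟨A', hA', hA'B⟩ := exists_mem_Sc_not_le hc0 hc1 hX le_sup_left hsup
  have hinf : A' ⊓ (X ⊔ B) = X :=
    Submodule.inf_eq_of_finrank_add_one_eq hA'.2.1 (hX.trans hA'.1.symm) le_sup_left hA'B
  have hle : A' ⊓ B ≤ X := (inf_le_inf_left A' le_sup_right).trans hinf.le
  have := Submodule.eq_of_le_of_finrank_eq hle (by have := hadj A' hA'; omega)
  exact hXB (this ▸ inf_le_right)

theorem Sc_injective (hkn : k + 2 ≤ n) {c : F} (hc0 : c ≠ 0) (hc1 : c ≠ 1)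
    {X X' : Submodule F (Fin n → F)} (hX : finrank F X + 1 = k) (hX' : finrank F X' + 1 = k)
    (h : Sc F n k X = Sc F n k X') : X = X' := by
  obtain ⟨A, hA, -⟩ := exists_mem_Sc_not_le hc0 hc1 hX le_rfl (by omega)
  have hAdim := hA.1
  obtain ⟨B, hB, hBA⟩ := exists_mem_Sc_not_le hc0 hc1 hX hA.2.1 (by omega)
  have hAB : A ≠ B := fun h => hBA h.ge
  rw [← finrank_inf_add_one_of_mem_Sc hX hA hB hAB]
  exact finrank_inf_add_one_of_mem_Sc hX' (h ▸ hA) (h ▸ hB) hAB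

theorem exists_adjK_mem_Sc (hk : 2 ≤ k) (hkn : k + 2 ≤ n)
    (hF : ∀ T : Finset F, T.card ≤ n - k → ∃ t, t ∉ T) {c : F} (hc0 : c ≠ 0) (hc1 : c ≠ 1)
    {X X' : Submodule F (Fin n → F)} (hX : finrank F X + 1 = k) (hX' : finrank F X' + 1 = k)
    (hinf : finrank F ↥(X ⊓ X') + 2 = k) :
    ∀ A ∈ Sc F n k X, ∃ B ∈ Sc F n k X', AdjK F n k A B := by
  classical
  intro A hA
  have hAdim := hA.1
  by_cases hX'A : X' ≤ A
  · obtain ⟨B, hB, hBA⟩ := exists_mem_Sc_not_le hc0 hc1 hX' hX'A (by omega)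
    have hAB : A ≠ B := fun h => hBA h.ge
    refine ⟨B, hB, hAB, ?_⟩
    rw [finrank_inf_add_one_of_mem_Sc hX' ⟨hA.1, hX'A, hA.2.2⟩ hB hAB]
    omega
  · have hcard : (Finset.univ.filter fun i => X' ≤ coordHyp F n i).card ≤ n - k + 1 := by
      have := card_add_finrank_le_s12 (X := X') (I := Finset.univ.filter fun i => X' ≤ coordHyp F n i)
        (by simp)
      omega
    have hAX' : ¬A ≤ X' := fun h => by
      have := Submodule.finrank_mono h
      omega
    have hgood : ∃ a ∈ A, a ∉ X' ∧ ∀ i, X' ≤ coordHyp F n i → a i ≠ 0 := by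
      by_cases hex : ∃ i, X' ≤ coordHyp F n i
      · obtain ⟨i, hi⟩ := hex
        obtain ⟨a, haA, ha⟩ := Submodule.exists_mem_forall_ne_zero hF
          (fun i => LinearMap.proj (R := F) (φ := fun _ : Fin n => F) i)
          (isNondeg_iff.1 hA.2.2) _ hcard
        have ha' : ∀ i, X' ≤ coordHyp F n i → a i ≠ 0 := fun i hi => ha i (by simpa using hi)
        exact ⟨a, haA, fun h => ha' i hi (hi h), ha'⟩
      · obtain ⟨a, haA, ha⟩ := SetLike.not_le_iff_exists.1 hAX'
        exact ⟨a, haA, ha, fun i hi => (hex ⟨i, hi⟩).elim⟩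
    obtain ⟨a, haA, haX', ha⟩ := hgood
    have haB : a ∈ X' ⊔ Submodule.span F {a} :=
      Submodule.mem_sup_right (Submodule.mem_span_singleton_self a)
    have hBdim : finrank F ↥(X' ⊔ Submodule.span F {a}) = k := by
      rw [Submodule.finrank_sup_span_singleton haX', hX']
    have hne : A ≠ X' ⊔ Submodule.span F {a} := fun h => hX'A (h ▸ le_sup_left)
    refine ⟨X' ⊔ Submodule.span F {a}, ⟨hBdim, le_sup_left, ?_⟩, hne, ?_⟩
    · rintro ⟨i, hi⟩
      exact ha i (le_sup_left.trans hi) (hi haB)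
    · have hlt : finrank F ↥(A ⊓ (X' ⊔ Submodule.span F {a})) < finrank F A :=
        Submodule.finrank_lt_finrank_of_lt (inf_lt_left.2 fun h =>
          hne (Submodule.eq_of_le_of_finrank_eq h (hAdim.trans hBdim.symm)))
      have hle : (X ⊓ X') ⊔ Submodule.span F {a} ≤ A ⊓ (X' ⊔ Submodule.span F {a}) :=
        le_inf (sup_le (inf_le_left.trans hA.2.1) (by simpa using haA))
          (sup_le_sup_right inf_le_right _)
      have h1 := Submodule.finrank_mono hle
      rw [Submodule.finrank_sup_span_singleton fun h => haX' (Submodule.mem_inf.1 h).2] at h1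
      omega

theorem adjMC_Sc_iff (hk : 2 ≤ k) (hkn : k + 2 ≤ n)
    (hF : ∀ T : Finset F, T.card ≤ n - k → ∃ t, t ∉ T) {c : F} (hc0 : c ≠ 0) (hc1 : c ≠ 1)
    {X X' : Submodule F (Fin n → F)} (hX : finrank F X + 1 = k) (hX' : finrank F X' + 1 = k) :
    AdjMC F n k (Sc F n k X) (Sc F n k X') ↔ finrank F ↥(X ⊓ X') + 2 = k := by
  refine ⟨fun ⟨hne, h, _⟩ => ?_, fun h => ⟨fun heq => ?_, ?_, ?_⟩⟩
  · have hXX' : X ≠ X' := fun h => hne (h ▸ rfl)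
    obtain ⟨A, hA, -⟩ := exists_mem_Sc_not_le hc0 hc1 hX le_rfl (by omega)
    obtain ⟨B, hB, hAB⟩ := h A hA
    have hsup : finrank F ↥(X ⊔ X') < n := by
      have h1 := Submodule.finrank_mono (sup_le_sup hA.2.1 hB.2.1)
      have h2 := Submodule.finrank_sup_add_finrank_inf_eq A B
      have h3 := finrank_inf_add_one_of_adjK hk hAB
      have h4 := hA.1
      have h5 := hB.1
      omega
    obtain ⟨A', hA', hA'W⟩ := exists_mem_Sc_not_le hc0 hc1 hX le_sup_left hsup
    obtain ⟨B', hB', hAB'⟩ := h A' hA'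
    have hinf : A' ⊓ (X ⊔ X') = X :=
      Submodule.inf_eq_of_finrank_add_one_eq hA'.2.1 (hX.trans hA'.1.symm) le_sup_left hA'W
    have hle : (A' ⊓ B') ⊓ X' ≤ X ⊓ X' :=
      le_inf ((le_inf (inf_le_left.trans inf_le_left) (inf_le_right.trans le_sup_right)).trans
        hinf.le) inf_le_right
    have h1 := Submodule.finrank_mono hle
    have h2 := Submodule.finrank_sup_add_finrank_inf_eq (A' ⊓ B') X'
    have h3 := finrank_inf_add_one_of_adjK hk hAB'
    have h4 := Submodule.finrank_mono (sup_le (inf_le_right : A' ⊓ B' ≤ B') hB'.2.1)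
    have h5 := hB'.1
    have h6 : finrank F ↥(X ⊓ X') < finrank F X :=
      Submodule.finrank_lt_finrank_of_lt (inf_lt_left.2 fun h =>
        hXX' (Submodule.eq_of_le_of_finrank_eq h (by omega)))
    omega
  · obtain rfl := Sc_injective hkn hc0 hc1 hX hX' heq
    rw [inf_idem] at h
    omega
  · exact exists_adjK_mem_Sc hk hkn hF hc0 hc1 hX hX' h
  · exact exists_adjK_mem_Sc hk hkn hF hc0 hc1 hX' hX (by rwa [inf_comm])

/-- The sets `S^c(X)` for the `(k-1)`-dimensional subspaces `X` of `Y`. -/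
def starsWithin (F : Type*) [Field F] (n k : ℕ) (Y : Submodule F (Fin n → F)) :
    Set (Set (Submodule F (Fin n → F))) :=
  {S | ∃ X : Submodule F (Fin n → F), finrank F X + 1 = k ∧ X ≤ Y ∧ S = Sc F n k X}

theorem IsStarD.exists_eq_Sc (hk : 2 ≤ k) {S : Set (Submodule F (Fin n → F))}
    (hS : IsStarD F n k S) :
    ∃ X : Submodule F (Fin n → F), finrank F X + 1 = k ∧ S = Sc F n k X := by
  obtain ⟨⟨X, hX, rfl⟩, -⟩ := hS
  exact ⟨X, by omega, rfl⟩

theorem IsCliqueDs'.isCliqueDs {𝔖 : Set (Set (Submodule F (Fin n → F)))}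
    (h : IsCliqueDs' F n k 𝔖) : IsCliqueDs F n k 𝔖 :=
  ⟨h.1, fun S hS S' hS' hne => (h.2 S hS S' hS' hne).1⟩

theorem finrank_inf_add_two_of_hyperplanes {X X' Y : Submodule F (Fin n → F)}
    (hX : finrank F X + 1 = k) (hX' : finrank F X' + 1 = k) (hY : finrank F Y = k)
    (hXY : X ≤ Y) (hX'Y : X' ≤ Y) (hne : X ≠ X') :
    X ⊔ X' = Y ∧ finrank F ↥(X ⊓ X') + 2 = k := by
  have hlt : finrank F X < finrank F ↥(X ⊔ X') :=
    Submodule.finrank_lt_finrank_of_lt (left_lt_sup.2 fun h =>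
      hne (Submodule.eq_of_le_of_finrank_eq h (by omega)).symm)
  have hsup : X ⊔ X' = Y := Submodule.eq_of_le_of_finrank_le (sup_le hXY hX'Y) (by omega)
  have h := Submodule.finrank_sup_add_finrank_inf_eq X X'
  rw [hsup] at h
  exact ⟨hsup, by omega⟩

theorem isCliqueDs_starsWithin (hk : 2 ≤ k) (hkn : k + 2 ≤ n)
    (hF : ∀ T : Finset F, T.card ≤ n - k → ∃ t, t ∉ T) {c : F} (hc0 : c ≠ 0) (hc1 : c ≠ 1)
    {Y : Submodule F (Fin n → F)} (hY : finrank F Y = k) :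
    IsCliqueDs F n k (starsWithin F n k Y) := by
  refine ⟨?_, ?_⟩
  · rintro _ ⟨X, hX, -, rfl⟩
    exact isStarD_Sc hk hkn hc0 hc1 hX
  · rintro _ ⟨X, hX, hXY, rfl⟩ _ ⟨X', hX', hX'Y, rfl⟩ hne
    rw [adjMC_Sc_iff hk hkn hF hc0 hc1 hX hX']
    exact (finrank_inf_add_two_of_hyperplanes hX hX' hY hXY hX'Y fun h => hne (h ▸ rfl)).2

theorem isSpecialStars_starsWithin (hk : 3 ≤ k) (hkn : k + 2 ≤ n)
    (hF : ∀ T : Finset F, T.card ≤ n - k → ∃ t, t ∉ T) {c : F} (hc0 : c ≠ 0) (hc1 : c ≠ 1)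
    {Y : Submodule F (Fin n → F)} (hY : finrank F Y = k) (hdeg : IsDeg F n Y) :
    IsSpecialStars F n k (starsWithin F n k Y) := by
  have hk2 : 2 ≤ k := by omega
  have hclique := isCliqueDs_starsWithin hk2 hkn hF hc0 hc1 hY
  have hmax : IsMaxCliqueDs F n k (starsWithin F n k Y) := by
    refine ⟨hclique, fun 𝔖 h𝔖 hle => subset_antisymm (fun S hS => ?_) hle⟩
    obtain ⟨X', hX', rfl⟩ := (h𝔖.1 S hS).exists_eq_Sc hk2
    by_cases hX'Y : X' ≤ Y
    · exact ⟨X', hX', hX'Y, rfl⟩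
    exfalso
    have hinf : ∀ X : Submodule F (Fin n → F), finrank F X + 1 = k → X ≤ Y →
        finrank F ↥(X' ⊓ X) + 2 = k := fun X hX hXY => by
      rw [← adjMC_Sc_iff hk2 hkn hF hc0 hc1 hX' hX]
      exact h𝔖.2 _ hS _ (hle ⟨X, hX, hXY, rfl⟩) fun h =>
        hX'Y (Sc_injective hkn hc0 hc1 hX' hX h ▸ hXY)
    have havoid : ∀ z ∈ Y, z ≠ 0 →
        ∃ X : Submodule F (Fin n → F), X ≤ Y ∧ finrank F X + 1 = finrank F Y ∧ z ∉ X :=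
      fun z hz hz0 => by
        obtain ⟨X, -, h⟩ := Submodule.exists_finrank_add_one_eq_of_notMem bot_le hz
          (by simpa using hz0)
        exact ⟨X, h⟩
    have hYbot : Y ≠ ⊥ := by
      rintro rfl
      rw [finrank_bot] at hY
      omega
    obtain ⟨y, hy, hy0⟩ := Submodule.exists_mem_ne_zero_of_ne_bot hYbot
    obtain ⟨X, hXY, hX, -⟩ := havoid y hy hy0
    have h1 := hinf X (by omega) hXY
    have hbot : X' ⊓ X ≠ ⊥ := fun h => by
      rw [h, finrank_bot] at h1
      omega
    obtain ⟨z, hz, hz0⟩ := Submodule.exists_mem_ne_zero_of_ne_bot hbot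
    obtain ⟨W, hWY, hW, hzW⟩ := havoid z (hXY hz.2) hz0
    have h2 := hinf W (by omega) hWY
    have h3 : finrank F ↥(X' ⊓ W) < finrank F ↥(X' ⊓ Y) :=
      Submodule.finrank_lt_finrank_of_lt (SetLike.lt_iff_le_and_exists.2
        ⟨inf_le_inf_left X' hWY, z, Submodule.mem_inf.2 ⟨hz.1, hXY hz.2⟩,
          fun h => hzW (Submodule.mem_inf.1 h).2⟩)
    have h4 : finrank F ↥(X' ⊓ Y) < finrank F X' :=
      Submodule.finrank_lt_finrank_of_lt (inf_lt_left.2 hX'Y)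
    omega
  refine ⟨hmax, ⟨hclique.1, ?_⟩, fun 𝔖 h𝔖 => hmax.2 𝔖 h𝔖.isCliqueDs⟩
  rintro _ ⟨X, hX, hXY, rfl⟩ _ ⟨X', hX', hX'Y, rfl⟩ hne
  refine ⟨hclique.2 _ ⟨X, hX, hXY, rfl⟩ _ ⟨X', hX', hX'Y, rfl⟩ hne,
    Set.eq_empty_of_forall_notMem fun A ⟨hA, hA'⟩ => hA.2.2 ?_⟩
  have hsup := (finrank_inf_add_two_of_hyperplanes hX hX' hY hXY hX'Y fun h => hne (h ▸ rfl)).1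
  have hYA : Y ≤ A := hsup ▸ sup_le hA.2.1 hA'.2.1
  rwa [← Submodule.eq_of_le_of_finrank_eq hYA (hY.trans hA.1.symm)]

theorem IsSpecialStars.inter_eq_empty {𝔖 : Set (Set (Submodule F (Fin n → F)))}
    (h𝔖 : IsSpecialStars F n k 𝔖) {S S' : Set (Submodule F (Fin n → F))} (hS : S ∈ 𝔖)
    (hS' : S' ∈ 𝔖) (hne : S ≠ S') : S ∩ S' = ∅ :=
  (h𝔖.2.1.2 S hS S' hS' hne).2

/-- A special set of stars has at least two elements. -/
theorem IsSpecialStars.nontrivial (hk : 2 ≤ k) (hkn : k + 2 ≤ n)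
    (hF : ∀ T : Finset F, T.card ≤ n - k → ∃ t, t ∉ T) {c : F} (hc0 : c ≠ 0) (hc1 : c ≠ 1)
    {𝔖 : Set (Set (Submodule F (Fin n → F)))} (h𝔖 : IsSpecialStars F n k 𝔖) :
    𝔖.Nontrivial := by
  by_contra hsub
  rw [Set.not_nontrivial_iff] at hsub
  have hX : ∃ X : Submodule F (Fin n → F), finrank F X + 1 = k ∧ 𝔖 ⊆ {Sc F n k X} := by
    rcases hsub.eq_empty_or_singleton with rfl | ⟨S, rfl⟩
    · obtain ⟨X, hX⟩ := Submodule.exists_finrank_eq (F := F) (V := Fin n → F) (d := k - 1)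
        (by simp; omega)
      exact ⟨X, by omega, Set.empty_subset _⟩
    · obtain ⟨X, hX, rfl⟩ := (h𝔖.1.1.1 S rfl).exists_eq_Sc hk
      exact ⟨X, hX, subset_rfl⟩
  obtain ⟨X, hX, hle⟩ := hX
  obtain ⟨A, hA, -⟩ := exists_mem_Sc_not_le hc0 hc1 hX le_rfl (by omega)
  have hAdim := hA.1
  have hmem : Sc F n k X ∈ starsWithin F n k A := ⟨X, hX, hA.2.1, rfl⟩
  have heq : starsWithin F n k A = 𝔖 :=
    h𝔖.1.2 _ (isCliqueDs_starsWithin hk hkn hF hc0 hc1 hAdim)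
      (hle.trans (Set.singleton_subset_iff.2 hmem))
  have hXbot : X ≠ ⊥ := by
    rintro rfl
    rw [finrank_bot] at hX
    omega
  obtain ⟨z, hz, hz0⟩ := Submodule.exists_mem_ne_zero_of_ne_bot hXbot
  obtain ⟨W, -, hWA, hW, hzW⟩ := Submodule.exists_finrank_add_one_eq_of_notMem bot_le
    (hA.2.1 hz) (by simpa using hz0)
  have hW' : finrank F W + 1 = k := by omega
  have hSc := hsub (heq ▸ hmem) (heq ▸ ⟨W, hW', hWA, rfl⟩ : Sc F n k W ∈ 𝔖)
  exact hzW (Sc_injective hkn hc0 hc1 hX hW' hSc ▸ hz)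

/-- In a special set, the stars do not all contain a common `(k-2)`-dimensional subspace. -/
theorem IsSpecialStars.exists_not_le (hk : 2 ≤ k) (hkn : k + 2 ≤ n)
    (hF : ∀ T : Finset F, T.card ≤ n - k → ∃ t, t ∉ T) {c : F} (hc0 : c ≠ 0) (hc1 : c ≠ 1)
    {𝔖 : Set (Set (Submodule F (Fin n → F)))} (h𝔖 : IsSpecialStars F n k 𝔖)
    {Z : Submodule F (Fin n → F)} (hZ : finrank F Z + 2 = k) :
    ∃ X : Submodule F (Fin n → F), finrank F X + 1 = k ∧ Sc F n k X ∈ 𝔖 ∧ ¬Z ≤ X := by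
  by_contra! hall
  let 𝔖Z : Set (Set (Submodule F (Fin n → F))) :=
    {S | ∃ X : Submodule F (Fin n → F), finrank F X + 1 = k ∧ Z ≤ X ∧ S = Sc F n k X}
  have hclique : IsCliqueDs F n k 𝔖Z := by
    refine ⟨?_, ?_⟩
    · rintro _ ⟨X, hX, -, rfl⟩
      exact isStarD_Sc hk hkn hc0 hc1 hX
    · rintro _ ⟨X, hX, hZX, rfl⟩ _ ⟨X', hX', hZX', rfl⟩ hne
      rw [adjMC_Sc_iff hk hkn hF hc0 hc1 hX hX']
      have h1 := Submodule.finrank_mono (le_inf hZX hZX')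
      have h2 : finrank F ↥(X ⊓ X') < finrank F X :=
        Submodule.finrank_lt_finrank_of_lt (inf_lt_left.2 fun h =>
          hne (Submodule.eq_of_le_of_finrank_eq h (by omega) ▸ rfl))
      omega
  have heq : 𝔖Z = 𝔖 := by
    refine h𝔖.1.2 _ hclique fun S hS => ?_
    obtain ⟨X, hX, rfl⟩ := (h𝔖.1.1.1 S hS).exists_eq_Sc hk
    exact ⟨X, hX, hall X hX hS, rfl⟩
  obtain ⟨S, hS, -⟩ := h𝔖.nontrivial hk hkn hF hc0 hc1
  obtain ⟨X, hX, hZX, rfl⟩ := heq.symm ▸ hS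
  obtain ⟨A, hA, -⟩ := exists_mem_Sc_not_le hc0 hc1 hX le_rfl (by omega)
  have hAdim := hA.1
  have hXZ : ¬X ≤ Z := fun h => by
    have := Submodule.finrank_mono h
    omega
  obtain ⟨z, hzX, hzZ⟩ := SetLike.not_le_iff_exists.1 hXZ
  obtain ⟨W, hZW, hWA, hW, hzW⟩ := Submodule.exists_finrank_add_one_eq_of_notMem
    (hZX.trans hA.2.1) (hA.2.1 hzX) hzZ
  have hW' : finrank F W + 1 = k := by omega
  have hempty := h𝔖.inter_eq_empty hS (heq ▸ ⟨W, hW', hZW, rfl⟩ : Sc F n k W ∈ 𝔖) fun h =>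
    hzW (Sc_injective hkn hc0 hc1 hX hW' h ▸ hzX)
  exact Set.eq_empty_iff_forall_notMem.1 hempty A ⟨hA, hA.1, hWA, hA.2.2⟩

theorem IsSpecialStars.exists_eq_starsWithin (hk : 2 ≤ k) (hkn : k + 2 ≤ n)
    (hF : ∀ T : Finset F, T.card ≤ n - k → ∃ t, t ∉ T) {c : F} (hc0 : c ≠ 0) (hc1 : c ≠ 1)
    {𝔖 : Set (Set (Submodule F (Fin n → F)))} (h𝔖 : IsSpecialStars F n k 𝔖) :
    ∃ Y : Submodule F (Fin n → F),
      finrank F Y = k ∧ IsDeg F n Y ∧ 𝔖 = starsWithin F n k Y := by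
  obtain ⟨S₁, hS₁, S₂, hS₂, hne⟩ := h𝔖.nontrivial hk hkn hF hc0 hc1
  obtain ⟨X₁, hX₁, rfl⟩ := (h𝔖.1.1.1 S₁ hS₁).exists_eq_Sc hk
  obtain ⟨X₂, hX₂, rfl⟩ := (h𝔖.1.1.1 S₂ hS₂).exists_eq_Sc hk
  have hinf : ∀ X X' : Submodule F (Fin n → F), finrank F X + 1 = k → finrank F X' + 1 = k →
      Sc F n k X ∈ 𝔖 → Sc F n k X' ∈ 𝔖 → X ≠ X' → finrank F ↥(X ⊓ X') + 2 = k :=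
    fun X X' hX hX' hS hS' hXX' =>
      (adjMC_Sc_iff hk hkn hF hc0 hc1 hX hX').1
        (h𝔖.1.1.2 _ hS _ hS' fun h => hXX' (Sc_injective hkn hc0 hc1 hX hX' h))
  have hZ := hinf X₁ X₂ hX₁ hX₂ hS₁ hS₂ fun h => hne (h ▸ rfl)
  have hY : finrank F ↥(X₁ ⊔ X₂) = k := by
    have := Submodule.finrank_sup_add_finrank_inf_eq X₁ X₂
    omega
  -- A member of the set not contained in `X₁ ⊔ X₂` meets it in `X₁ ⊓ X₂`.
  have hout : ∀ X : Submodule F (Fin n → F), finrank F X + 1 = k → Sc F n k X ∈ 𝔖 →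
      ¬X ≤ X₁ ⊔ X₂ → X ⊓ (X₁ ⊔ X₂) = X₁ ⊓ X₂ := fun X hX hS hXY => by
    have hlt : finrank F ↥(X ⊓ (X₁ ⊔ X₂)) < finrank F X :=
      Submodule.finrank_lt_finrank_of_lt (inf_lt_left.2 hXY)
    have h1 := hinf X X₁ hX hX₁ hS hS₁ fun h => hXY (h.le.trans le_sup_left)
    have h2 := hinf X X₂ hX hX₂ hS hS₂ fun h => hXY (h.le.trans le_sup_right)
    have e1 : X ⊓ X₁ = X ⊓ (X₁ ⊔ X₂) :=
      Submodule.eq_of_le_of_finrank_le (inf_le_inf_left X le_sup_left) (by omega)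
    have e2 : X ⊓ X₂ = X ⊓ (X₁ ⊔ X₂) :=
      Submodule.eq_of_le_of_finrank_le (inf_le_inf_left X le_sup_right) (by omega)
    refine Submodule.eq_of_le_of_finrank_le
      (le_inf (e1.ge.trans inf_le_right) (e2.ge.trans inf_le_right)) ?_
    rw [← e1]
    omega
  have hle : 𝔖 ⊆ starsWithin F n k (X₁ ⊔ X₂) := by
    intro S₃ hS₃
    obtain ⟨X₃, hX₃, rfl⟩ := (h𝔖.1.1.1 S₃ hS₃).exists_eq_Sc hk
    refine ⟨X₃, hX₃, ?_, rfl⟩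
    by_contra hX₃Y
    obtain ⟨X, hX, hS, hZX⟩ := h𝔖.exists_not_le hk hkn hF hc0 hc1 hZ
    have h3 := hout X₃ hX₃ hS₃ hX₃Y
    by_cases hXY : X ≤ X₁ ⊔ X₂
    · have h4 := hinf X₃ X hX₃ hX hS₃ hS fun h => hX₃Y (h ▸ hXY)
      have h5 : X₃ ⊓ X ≤ X₁ ⊓ X₂ := (inf_le_inf_left X₃ hXY).trans h3.le
      exact hZX ((Submodule.eq_of_le_of_finrank_le h5 (by omega)).ge.trans inf_le_right)
    · exact hZX ((hout X hX hS hXY).ge.trans inf_le_left)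
  refine ⟨X₁ ⊔ X₂, hY, ?_, (h𝔖.1.2 _ (isCliqueDs_starsWithin hk hkn hF hc0 hc1 hY) hle).symm⟩
  by_contra hnd
  exact Set.eq_empty_iff_forall_notMem.1 (h𝔖.inter_eq_empty hS₁ hS₂ hne) (X₁ ⊔ X₂)
    ⟨⟨hY, le_sup_left, hnd⟩, hY, le_sup_right, hnd⟩

theorem exists_mem_starsWithin_iff {A Y : Submodule F (Fin n → F)} (hA : finrank F A = k)
    (hAnd : IsNondeg F n A) (hY : finrank F Y = k) (hYdeg : IsDeg F n Y) (hk : 2 ≤ k) :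
    (∃ S ∈ starsWithin F n k Y, A ∈ S) ↔ finrank F ↥(A ⊓ Y) = k - 1 := by
  constructor
  · rintro ⟨_, ⟨X, hX, hXY, rfl⟩, -, hXA, -⟩
    rw [Submodule.inf_eq_of_finrank_add_one_eq hXA (hX.trans hA.symm) hXY fun h =>
      hAnd (Submodule.eq_of_le_of_finrank_eq h (hA.trans hY.symm) ▸ hYdeg)]
    omega
  · intro h
    exact ⟨_, ⟨A ⊓ Y, by omega, inf_le_right, rfl⟩, hA, inf_le_left, hAnd⟩

theorem exists_mem_starsWithin_inter_iff (hk : 2 ≤ k) (hkn : k + 2 ≤ n) {c : F} (hc0 : c ≠ 0)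
    (hc1 : c ≠ 1) {Y Y' : Submodule F (Fin n → F)} (hY : finrank F Y = k)
    (hY' : finrank F Y' = k) (hne : Y ≠ Y') :
    (∃ S, S ∈ starsWithin F n k Y ∧ S ∈ starsWithin F n k Y') ↔
      finrank F ↥(Y ⊓ Y') = k - 1 := by
  constructor
  · rintro ⟨_, ⟨X, hX, hXY, rfl⟩, X', hX', hX'Y', h⟩
    obtain rfl := Sc_injective hkn hc0 hc1 hX hX' h
    rw [Submodule.inf_eq_of_finrank_add_one_eq hXY (hX.trans hY.symm) hX'Y' fun h =>
      hne (Submodule.eq_of_le_of_finrank_eq h (hY.trans hY'.symm))]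
    omega
  · intro h
    exact ⟨_, ⟨Y ⊓ Y', by omega, inf_le_left, rfl⟩, Y ⊓ Y', by omega, inf_le_right, rfl⟩

theorem starsWithin_injective (hk : 2 ≤ k) (hkn : k + 2 ≤ n) {c : F} (hc0 : c ≠ 0)
    (hc1 : c ≠ 1) {Y Y' : Submodule F (Fin n → F)} (hY : finrank F Y = k)
    (hY' : finrank F Y' = k) (h : starsWithin F n k Y = starsWithin F n k Y') : Y = Y' := by
  refine Submodule.eq_of_le_of_finrank_eq (fun y hy => ?_) (hY.trans hY'.symm)
  by_contra hyY'
  have hle : ∀ X : Submodule F (Fin n → F), finrank F X + 1 = k → X ≤ Y → X ≤ Y' :=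
    fun X hX hXY => by
      obtain ⟨X', hX', hX'Y', hSc⟩ : Sc F n k X ∈ starsWithin F n k Y' := h ▸ ⟨X, hX, hXY, rfl⟩
      exact Sc_injective hkn hc0 hc1 hX hX' hSc ▸ hX'Y'
  have hy0 : y ≠ 0 := fun h => hyY' (h ▸ Y'.zero_mem)
  have hYy : ¬Y ≤ Submodule.span F {y} := fun h => by
    have := Submodule.finrank_mono h
    rw [finrank_span_singleton hy0] at this
    omega
  obtain ⟨z, hzY, hzy⟩ := SetLike.not_le_iff_exists.1 hYy
  obtain ⟨X, hyX, hXY, hX, -⟩ := Submodule.exists_finrank_add_one_eq_of_notMem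
    ((Submodule.span_singleton_le_iff_mem y Y).2 hy) hzY hzy
  exact hyY' (hle X (by omega) hXY (hyX (Submodule.mem_span_singleton_self y)))

end Stars

/-- for `|F| > n - k` and `k ≥ 3`, the graph `Γ_s` is isomorphic to the
Grassmann graph `Γ_k(V)` by an isomorphism fixing every non-degenerate `k`-dimensional
subspace. -/
theorem stmt12 (F : Type*) [Field F] (n k : ℕ)
    (hk1 : 1 < k) (hk2 : k < n - 1) (hk3 : 3 ≤ k)
    (hF : (↑(n - k) : Cardinal) < Cardinal.mk F) :
    ∃ φ : GammaS F n k ≃g GrassmannGraph F n k,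
      ∀ A : {A : Submodule F (Fin n → F) // finrank F ↥A = k ∧ IsNondeg F n A},
        (φ (Sum.inl A)).1 = A.1 := by
  classical
  have hk : 2 ≤ k := hk1
  have hkn : k + 2 ≤ n := by omega
  have hF' := exists_notMem_of_lt_mk hF
  obtain ⟨c, hc⟩ := hF' {0, 1} (Finset.card_le_two.trans (by omega))
  obtain ⟨hc0, hc1⟩ : c ≠ 0 ∧ c ≠ 1 := by simpa using hc
  let g : {A : Submodule F (Fin n → F) // finrank F ↥A = k} →
      ({A : Submodule F (Fin n → F) // finrank F ↥A = k ∧ IsNondeg F n A} ⊕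
        {𝔖 : Set (Set (Submodule F (Fin n → F))) // IsSpecialStars F n k 𝔖}) := fun A =>
    if h : IsDeg F n A.1 then
      Sum.inr ⟨starsWithin F n k A.1, isSpecialStars_starsWithin hk3 hkn hF' hc0 hc1 A.2 h⟩
    else Sum.inl ⟨A.1, A.2, h⟩
  have hg_deg : ∀ A (h : IsDeg F n A.1), g A = Sum.inr ⟨starsWithin F n k A.1,
      isSpecialStars_starsWithin hk3 hkn hF' hc0 hc1 A.2 h⟩ := fun A h => dif_pos h
  have hg_nondeg : ∀ A (h : IsNondeg F n A.1), g A = Sum.inl ⟨A.1, A.2, h⟩ :=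
    fun A h => dif_neg h
  have hg : Function.Bijective g := by
    refine ⟨fun A B hAB => Subtype.ext ?_, ?_⟩
    · by_cases hA : IsDeg F n A.1 <;> by_cases hB : IsDeg F n B.1
      · rw [hg_deg A hA, hg_deg B hB] at hAB
        exact starsWithin_injective hk hkn hc0 hc1 A.2 B.2
          (congrArg Subtype.val (Sum.inr_injective hAB))
      · simp [hg_deg A hA, hg_nondeg B hB] at hAB
      · simp [hg_nondeg A hA, hg_deg B hB] at hAB
      · rw [hg_nondeg A hA, hg_nondeg B hB] at hAB
        simpa using congrArg Subtype.val (Sum.inl_injective hAB)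
    · rintro (⟨A, hA, hAnd⟩ | ⟨𝔖, h𝔖⟩)
      · exact ⟨⟨A, hA⟩, hg_nondeg ⟨A, hA⟩ hAnd⟩
      · obtain ⟨Y, hY, hdeg, rfl⟩ := h𝔖.exists_eq_starsWithin hk hkn hF' hc0 hc1
        exact ⟨⟨Y, hY⟩, hg_deg ⟨Y, hY⟩ hdeg⟩
  have hadj : ∀ A B, (GammaS F n k).Adj (g A) (g B) ↔ (GrassmannGraph F n k).Adj A B := by
    intro A B
    rw [GammaS, GrassmannGraph, SimpleGraph.fromRel_adj, SimpleGraph.fromRel_adj,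
      hg.injective.ne_iff]
    refine and_congr_right fun hne => ?_
    have hne' : A.1 ≠ B.1 := fun h => hne (Subtype.ext h)
    by_cases hA : IsDeg F n A.1 <;> by_cases hB : IsDeg F n B.1
    · rw [hg_deg A hA, hg_deg B hB]
      exact or_congr (exists_mem_starsWithin_inter_iff hk hkn hc0 hc1 A.2 B.2 hne')
        (exists_mem_starsWithin_inter_iff hk hkn hc0 hc1 B.2 A.2 hne'.symm)
    · rw [hg_deg A hA, hg_nondeg B hB, inf_comm A.1 B.1]
      exact or_congr (exists_mem_starsWithin_iff B.2 hB A.2 hA hk)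
        (exists_mem_starsWithin_iff B.2 hB A.2 hA hk)
    · rw [hg_nondeg A hA, hg_deg B hB, inf_comm B.1 A.1]
      exact or_congr (exists_mem_starsWithin_iff A.2 hA B.2 hB hk)
        (exists_mem_starsWithin_iff A.2 hA B.2 hB hk)
    · rw [hg_nondeg A hA, hg_nondeg B hB]
      exact or_congr (and_iff_right hne') (and_iff_right hne'.symm)
  let φ : GrassmannGraph F n k ≃g GammaS F n k := ⟨Equiv.ofBijective g hg, hadj _ _⟩
  refine ⟨φ.symm, fun A => ?_⟩
  have hφ : φ ⟨A.1, A.2.1⟩ = Sum.inl A := hg_nondeg ⟨A.1, A.2.1⟩ A.2.2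
  rw [← hφ, RelIso.symm_apply_apply]
end
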